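/- arXiv:1109.4472 — 2 statements merged into one kernel-verified Lean document; each statement's English description precedes it below -/
import Mathlib

section
/- For every δ > 0 there exist ε > 0 and n₀ such that for every integer n ≥ n₀, every simple graph G on n vertices that contains no clique K_{19} and satisfies α_{12}(G) ≤ εn has at most (1/8 + δ)·n² edges. (Thus θ_{12}(K_{19}) ≤ 1/8; combined with the matching construction this gives θ_{12}(K_{19}) = 1/8.) -/
open Finset

/-- the weighted quadratic form -/
noncomputable def rtF {ι : Type*} (s : Finset ι) (w : ι → ι → ℝ) (x : ι → ℝ) : ℝ :=
  ∑ i ∈ s, ∑ j ∈ s, w i j * x i * x j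

lemma rtF_insert {ι : Type*} [DecidableEq ι] (r : Finset ι) (a : ι) (ha : a ∉ r)
    (w : ι → ι → ℝ) (x : ι → ℝ) (hs : ∀ i j, w i j = w j i) (h0 : ∀ i, w i i = 0) :
    rtF (insert a r) w x = rtF r w x + 2 * x a * ∑ k ∈ r, w a k * x k := by
  unfold rtF
  rw [sum_insert ha, sum_insert ha, h0]
  simp_rw [sum_insert ha]
  rw [sum_add_distrib]
  have : ∑ i ∈ r, w i a * x i * x a = x a * ∑ k ∈ r, w a k * x k := by
    rw [mul_sum]; refine sum_congr rfl fun i _ => ?_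
    rw [hs i a]; ring
  have h2 : ∑ i ∈ r, w a i * x a * x i = x a * ∑ k ∈ r, w a k * x k := by
    rw [mul_sum]; refine sum_congr rfl fun i _ => ?_
    ring
  rw [this, h2]; ring

lemma rtF_congr {ι : Type*} (s : Finset ι) (w : ι → ι → ℝ) (x y : ι → ℝ)
    (h : ∀ i ∈ s, x i = y i) : rtF s w x = rtF s w y := by
  unfold rtF
  refine sum_congr rfl fun i hi => sum_congr rfl fun j hj => ?_
  rw [h i hi, h j hj]

lemma rtF_le {ι : Type*} [DecidableEq ι] (s : Finset ι) (w : ι → ι → ℝ) (x : ι → ℝ)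
    (h0 : ∀ i, w i i = 0) (hx : ∀ i, 0 ≤ x i)
    (c : ℝ) (hc : ∀ i ∈ s, ∀ j ∈ s, i ≠ j → w i j ≤ c) :
    rtF s w x ≤ c * ((∑ i ∈ s, x i) ^ 2 - ∑ i ∈ s, x i ^ 2) := by
  have : c * ((∑ i ∈ s, x i) ^ 2 - ∑ i ∈ s, x i ^ 2)
      = ∑ i ∈ s, ∑ j ∈ s, (if i = j then 0 else c) * x i * x j := by
    rw [sq, sum_mul_sum, ← sum_sub_distrib, mul_sum]
    refine sum_congr rfl fun i hi => ?_
    have : x i ^ 2 = ∑ j ∈ s, if i = j then x i * x j else 0 := by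
      rw [sum_ite_eq]; simp [hi, sq]
    rw [this, ← sum_sub_distrib, mul_sum]
    refine sum_congr rfl fun j hj => ?_
    split_ifs <;> ring
  rw [this]
  unfold rtF
  refine sum_le_sum fun i hi => sum_le_sum fun j hj => ?_
  have h1 := hx i
  have h2 := hx j
  by_cases hij : i = j
  · subst hij; simp [h0]
  · simp only [hij, if_false]
    have := hc i hi j hj hij
    gcongr

lemma rt_three (p q r x y z : ℝ) (hx : 0 ≤ x) (hy : 0 ≤ y) (hz : 0 ≤ z)
    (hp : p ≤ 5/12) (hq : q ≤ 5/12) (hr : r ≤ 1/4) :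
    2 * (p * (x * y) + q * (x * z) + r * (y * z)) ≤ 1/4 * (x + y + z) ^ 2 := by
  have h1 : p * (x * y) ≤ 5/12 * (x * y) := by gcongr
  have h2 : q * (x * z) ≤ 5/12 * (x * z) := by gcongr
  have h3 : r * (y * z) ≤ 1/4 * (y * z) := by gcongr
  nlinarith [sq_nonneg (y - z), sq_nonneg (3 * x - 2 * (y + z)), sq_nonneg (y + z)]

lemma rt_three' (p q r x y z : ℝ) (hx : 0 ≤ x) (hy : 0 ≤ y) (hz : 0 ≤ z)
    (hp : p ≤ 1/3) (hq : q ≤ 1/3) (hr : r ≤ 1/3) :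
    2 * (p * (x * y) + q * (x * z) + r * (y * z)) ≤ 1/4 * (x + y + z) ^ 2 := by
  have h1 : p * (x * y) ≤ 1/3 * (x * y) := by gcongr
  have h2 : q * (x * z) ≤ 1/3 * (x * z) := by gcongr
  have h3 : r * (y * z) ≤ 1/3 * (y * z) := by gcongr
  nlinarith [sq_nonneg (y - z), sq_nonneg (x - y), sq_nonneg (x - z)]

lemma rt_lagrange {ι : Type*} [DecidableEq ι] (w : ι → ι → ℝ)
    (hs : ∀ i j, w i j = w j i) (h0 : ∀ i, w i i = 0) (hw : ∀ i j, 0 ≤ w i j)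
    (m : ℕ) : ∀ (s : Finset ι) (_ : #s = m) (x : ι → ℝ) (_ : ∀ i, 0 ≤ x i)
    (_ : ∀ i ∈ s, ∀ j ∈ s, i ≠ j → ∀ J ⊆ s, i ∉ J → j ∉ J → #J ≤ 3 →
      (∀ a ∈ insert i (insert j J), ∀ b ∈ insert i (insert j J), a ≠ b → 0 < w a b) →
      w i j ≤ (6 - #J : ℝ) / 12)
    (_ : ∀ i ∈ s, ∀ j ∈ s, ∀ k ∈ s, i ≠ j → i ≠ k → j ≠ k →
      1/3 < w i j → 1/4 < w i k → 1/4 < w j k → False),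
    rtF s w x ≤ 1/4 * (∑ i ∈ s, x i) ^ 2 := by
  induction m with
  | zero =>
    intro s hm x hx _ _
    rw [card_eq_zero] at hm
    subst hm; simp [rtF]
  | succ m ih =>
    intro s hm x hx hA hB
    by_cases hcl : ∀ i ∈ s, ∀ j ∈ s, i ≠ j → 0 < w i j
    · -- clique case
      have hJ : ∀ t : ℕ, t ≤ 3 → t + 2 ≤ #s → ∀ i ∈ s, ∀ j ∈ s, i ≠ j → w i j ≤ (6 - t : ℝ) / 12 := by
        intro t ht hts i hi j hj hij
        have hc : t ≤ #((s.erase i).erase j) := by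
          rw [card_erase_of_mem (by simp [hj, hij.symm]), card_erase_of_mem hi]; omega
        obtain ⟨J, hJs, hJc⟩ := exists_subset_card_eq hc
        have hJs' : J ⊆ s := fun a ha => by
          have := hJs ha; simp at this; exact this.2.2
        have := hA i hi j hj hij J hJs' (fun h => by have := hJs h; simp at this)
          (fun h => by have := hJs h; simp at this) (by omega) (by
            have hsub : insert i (insert j J) ⊆ s := by
              intro a ha; simp only [mem_insert] at ha
              rcases ha with rfl | rfl | h
              exacts [hi, hj, hJs' h]
            intro a ha b hb hab
            exact hcl a (hsub ha) b (hsub hb) hab)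
        rwa [hJc] at this
      have hCS : (∑ i ∈ s, x i) ^ 2 ≤ (#s : ℝ) * ∑ i ∈ s, x i ^ 2 := sq_sum_le_card_mul_sum_sq
      have hSq : 0 ≤ ∑ i ∈ s, x i ^ 2 := sum_nonneg fun i _ => sq_nonneg _
      by_cases h5 : 5 ≤ #s
      · have := rtF_le s w x h0 hx (1/4) (fun i hi j hj hij => by
          have := hJ 3 le_rfl h5 i hi j hj hij; norm_num at this ⊢; exact this)
        linarith
      by_cases h4 : #s = 4
      · have := rtF_le s w x h0 hx (1/3) (fun i hi j hj hij => by
          have := hJ 2 (by norm_num) (by omega) i hi j hj hij; norm_num at this ⊢; exact this)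
        rw [h4] at hCS; push_cast at hCS
        linarith
      by_cases h3 : #s = 3
      · have h5 := hJ 1 (by norm_num) (by omega)
        obtain ⟨a, b, c, hab, hac, hbc, rfl⟩ := card_eq_three.1 h3
        have ma : a ∈ ({a, b, c} : Finset ι) := by simp
        have mb : b ∈ ({a, b, c} : Finset ι) := by simp
        have mc : c ∈ ({a, b, c} : Finset ι) := by simp
        have e1 : rtF {a, b, c} w x
            = 2 * (w a b * (x a * x b) + w a c * (x a * x c) + w b c * (x b * x c)) := by
          unfold rtF
          simp [sum_insert, hab, hac, hbc, h0]
          rw [hs b a, hs c a, hs c b]; ring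
        have e2 : ∑ i ∈ ({a, b, c} : Finset ι), x i = x a + x b + x c := by
          simp [sum_insert, hab, hac, hbc]; ring
        rw [e1, e2]
        have b1 := h5 a ma b mb hab
        have b2 := h5 a ma c mc hac
        have b3 := h5 b mb c mc hbc
        norm_num at b1 b2 b3
        by_cases q3 : w b c ≤ 1/4
        · exact rt_three _ _ _ _ _ _ (hx a) (hx b) (hx c) b1 b2 q3
        by_cases q2 : w a c ≤ 1/4
        · have := rt_three _ _ _ _ _ _ (hx b) (hx a) (hx c) b1 b3 q2
          linarith
        by_cases q1 : w a b ≤ 1/4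
        · have := rt_three _ _ _ _ _ _ (hx c) (hx a) (hx b) b2 b3 q1
          linarith
        push Not at q1 q2 q3
        apply rt_three' _ _ _ _ _ _ (hx a) (hx b) (hx c)
        · by_contra h; push Not at h
          exact hB a ma b mb c mc hab hac hbc h q2 q3
        · by_contra h; push Not at h
          exact hB a ma c mc b mb hac hab hbc.symm h q1 (by rwa [hs])
        · by_contra h; push Not at h
          exact hB b mb c mc a ma hbc hab.symm hac.symm h (by rwa [hs]) (by rwa [hs])
      by_cases h2 : #s = 2
      · have := rtF_le s w x h0 hx (1/2) (fun i hi j hj hij => by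
          have := hJ 0 (by norm_num) (by omega) i hi j hj hij; norm_num at this ⊢; exact this)
        rw [h2] at hCS; push_cast at hCS
        linarith
      · have := rtF_le s w x h0 hx 0 (fun i hi j hj hij => by
          exfalso
          have : 1 < #s := one_lt_card.2 ⟨i, hi, j, hj, hij⟩
          omega)
        have := sq_nonneg (∑ i ∈ s, x i)
        linarith
    · push Not at hcl
      have key : ∀ i ∈ s, ∀ j ∈ s, i ≠ j → w i j = 0 →
          ∑ k ∈ (s.erase i).erase j, w i k * x k ≤ ∑ k ∈ (s.erase i).erase j, w j k * x k →
          rtF s w x ≤ 1/4 * (∑ i ∈ s, x i) ^ 2 := by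
        intro i hi j hj hij hwij hle
        set r := (s.erase i).erase j with hr
        have hjr : j ∉ r := by simp [hr]
        have hir : i ∉ insert j r := by simp [hr, hij]
        have hse : s.erase i = insert j r := by
          rw [hr, insert_erase]; simp [hj, hij.symm]
        have hsi : s = insert i (insert j r) := by rw [← hse, insert_erase hi]
        let y : ι → ℝ := Function.update x j (x i + x j)
        have hyj : y j = x i + x j := by simp [y]
        have hyr : ∀ k ∈ r, y k = x k := fun k hk => by
          have : k ≠ j := fun h => hjr (h ▸ hk)
          simp [y, this]
        have hy : ∀ k, 0 ≤ y k := fun k => by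
          by_cases h : k = j
          · rw [h, hyj]; exact add_nonneg (hx _) (hx _)
          · simp [y, h, hx]
        have hsub : s.erase i ⊆ s := erase_subset _ _
        have := ih (s.erase i) (by rw [card_erase_of_mem hi]; omega) y hy
          (fun a ha b hb hab J hJ => hA a (hsub ha) b (hsub hb) hab J (hJ.trans hsub))
          (fun a ha b hb c hc => hB a (hsub ha) b (hsub hb) c (hsub hc))
        rw [hse, rtF_insert r j hjr w y hs h0, sum_insert hjr, hyj, sum_congr rfl hyr,
          rtF_congr r w y x hyr, sum_congr rfl (fun k hk => by rw [hyr k hk])] at this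
        rw [hsi, rtF_insert _ i hir w x hs h0, rtF_insert r j hjr w x hs h0, sum_insert hir,
          sum_insert hjr, sum_insert hjr, hwij]
        have h3 := mul_le_mul_of_nonneg_left hle (hx i)
        rw [← add_assoc]
        linarith
      obtain ⟨i, hi, j, hj, hij, hle⟩ := hcl
      have hwij : w i j = 0 := le_antisymm hle (hw i j)
      rcases le_total (∑ k ∈ (s.erase i).erase j, w i k * x k)
        (∑ k ∈ (s.erase i).erase j, w j k * x k) with h | h
      · exact key i hi j hj hij hwij h
      · refine key j hj i hi hij.symm (by rw [hs, hwij]) ?_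
        rwa [erase_right_comm]

/-- lower-regularity with an absolute size threshold -/
def rtDn {α : Type*} (G : SimpleGraph α) [DecidableRel G.Adj] (μ d : ℝ) (A B : Finset α) : Prop :=
  ∀ A' ⊆ A, ∀ B' ⊆ B, μ ≤ #A' → μ ≤ #B' → d * (#A' * #B') ≤ #(G.interedges A' B')

section
set_option linter.unusedSectionVars false
variable {α : Type*} [DecidableEq α] {G : SimpleGraph α} [DecidableRel G.Adj]

lemma rtDn.sub {μ d : ℝ} {A B A' B' : Finset α} (h : rtDn G μ d A B) (hA : A' ⊆ A) (hB : B' ⊆ B) :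
    rtDn G μ d A' B' :=
  fun X hX Y hY => h X (hX.trans hA) Y (hY.trans hB)

lemma rt_interedges (A B : Finset α) :
    #(G.interedges A B) = ∑ v ∈ A, #{b ∈ B | G.Adj v b} := by
  rw [SimpleGraph.interedges, Rel.interedges, card_filter, sum_product]
  simp_rw [card_filter]

lemma rt_bad {μ d : ℝ} (hμ : 0 < μ) {A B : Finset α} (h : rtDn G μ d A B) (hB : μ ≤ #B) :
    (#{v ∈ A | (#{b ∈ B | G.Adj v b} : ℝ) < d * #B} : ℝ) < μ := by
  by_contra hc
  push Not at hc
  set X := {v ∈ A | (#{b ∈ B | G.Adj v b} : ℝ) < d * #B} with hX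
  have h1 := h X (filter_subset _ _) B subset_rfl hc hB
  rw [rt_interedges] at h1
  push_cast at h1
  have hne : X.Nonempty := by
    rw [← card_pos]; exact_mod_cast hμ.trans_le hc
  have h2 : ∑ v ∈ X, (#{b ∈ B | G.Adj v b} : ℝ) < ∑ v ∈ X, d * #B :=
    sum_lt_sum_of_nonempty hne fun v hv => (mem_filter.1 hv).2
  rw [sum_const, nsmul_eq_mul] at h2
  linarith

lemma rt_good {ι : Type*} [DecidableEq ι] {μ : ℝ} (hμ : 0 < μ) (A : Finset α) (V : ι → Finset α)
    (d : ι → ℝ) (I : Finset ι) (h : ∀ i ∈ I, rtDn G μ (d i) A (V i))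
    (hV : ∀ i ∈ I, μ ≤ #(V i)) :
    ∃ A' ⊆ A, (#A : ℝ) - #I * μ ≤ #A' ∧
      ∀ v ∈ A', ∀ i ∈ I, d i * #(V i) ≤ #{b ∈ V i | G.Adj v b} := by
  induction I using Finset.induction_on with
  | empty => exact ⟨A, subset_rfl, by simp, by simp⟩
  | insert a I ha ih =>
    obtain ⟨A', hA', hc, hg⟩ := ih (fun i hi => h i (mem_insert_of_mem hi))
      (fun i hi => hV i (mem_insert_of_mem hi))
    have hb := rt_bad hμ ((h a (mem_insert_self _ _)).sub hA' subset_rfl) (hV a (mem_insert_self _ _))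
    refine ⟨{v ∈ A' | ¬ (#{b ∈ V a | G.Adj v b} : ℝ) < d a * #(V a)},
      (filter_subset _ _).trans hA', ?_, ?_⟩
    · have := card_filter_add_card_filter_not (s := A')
        (fun v => (#{b ∈ V a | G.Adj v b} : ℝ) < d a * #(V a))
      have h2 : (#{v ∈ A' | (#{b ∈ V a | G.Adj v b} : ℝ) < d a * #(V a)} : ℝ)
        + #{v ∈ A' | ¬ (#{b ∈ V a | G.Adj v b} : ℝ) < d a * #(V a)} = #A' := by exact_mod_cast this
      rw [card_insert_of_notMem ha]; push_cast
      linarith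
    · intro v hv i hi
      rw [mem_filter] at hv
      rcases mem_insert.1 hi with rfl | hi
      · exact not_lt.1 hv.2
      · exact hg v hv.1 i hi

lemma rt_pigeon {η d : ℝ} (hη : 0 < η) (Q B : Finset α) (k : ℕ) (hQ : #Q ≤ 12) (hQ0 : 0 < #Q)
    (hB0 : 0 < #B)
    (hd : (k : ℝ) + η * #Q ≤ d * #Q)
    (h : ∀ q ∈ Q, d * #B ≤ #{b ∈ B | G.Adj q b}) :
    ∃ Q' ⊆ Q, #Q' = k + 1 ∧ η / 4096 * #B ≤ #{b ∈ B | ∀ q ∈ Q', G.Adj q b} := by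
  have hQr : (0 : ℝ) < #Q := by exact_mod_cast hQ0
  -- double counting
  have e1 : ∑ q ∈ Q, #{b ∈ B | G.Adj q b} = ∑ b ∈ B, #{q ∈ Q | G.Adj q b} := by
    simp_rw [card_filter]; exact sum_comm
  have e1' : ∑ q ∈ Q, (#{b ∈ B | G.Adj q b} : ℝ) = ∑ b ∈ B, (#{q ∈ Q | G.Adj q b} : ℝ) := by
    exact_mod_cast e1
  have e2 : (#Q : ℝ) * (d * #B) ≤ ∑ q ∈ Q, (#{b ∈ B | G.Adj q b} : ℝ) := by
    have := sum_le_sum h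
    rwa [sum_const, nsmul_eq_mul] at this
  set R := {b ∈ B | k + 1 ≤ #{q ∈ Q | G.Adj q b}} with hR
  have e3 : ∑ b ∈ B, (#{q ∈ Q | G.Adj q b} : ℝ) ≤ k * #B + #Q * #R := by
    have : ∑ b ∈ B, (#{q ∈ Q | G.Adj q b} : ℝ)
        ≤ ∑ b ∈ B, ((k : ℝ) + #Q * (if k + 1 ≤ #{q ∈ Q | G.Adj q b} then 1 else 0)) := by
      refine sum_le_sum fun b _ => ?_
      split_ifs with hh
      · have : (#{q ∈ Q | G.Adj q b} : ℝ) ≤ #Q := by exact_mod_cast card_filter_le _ _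
        have hk : (0 : ℝ) ≤ k := Nat.cast_nonneg _
        linarith
      · have : #{q ∈ Q | G.Adj q b} ≤ k := by omega
        have : (#{q ∈ Q | G.Adj q b} : ℝ) ≤ k := by exact_mod_cast this
        linarith
    refine this.trans (le_of_eq ?_)
    rw [sum_add_distrib, sum_const, nsmul_eq_mul, ← mul_sum, hR, card_filter]
    push_cast; ring
  have hBn : (0 : ℝ) ≤ #B := Nat.cast_nonneg _
  have e4 : η * #B ≤ #R := by
    have h1 := mul_le_mul_of_nonneg_right hd hBn
    have h2 : (#Q : ℝ) * (η * #B) ≤ #Q * #R := by linarith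
    exact le_of_mul_le_mul_left h2 hQr
  by_contra hcon
  push Not at hcon
  have hsub : R ⊆ (powersetCard (k+1) Q).biUnion fun Q' => {b ∈ B | ∀ q ∈ Q', G.Adj q b} := by
    intro b hb
    rw [hR, mem_filter] at hb
    obtain ⟨Q', hQ', hc⟩ := exists_subset_card_eq hb.2
    rw [mem_biUnion]
    refine ⟨Q', mem_powersetCard.2 ⟨hQ'.trans (filter_subset _ _), hc⟩, ?_⟩
    rw [mem_filter]
    exact ⟨hb.1, fun q hq => (mem_filter.1 (hQ' hq)).2⟩
  have hpc : #(powersetCard (k+1) Q) ≤ 4096 := by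
    calc _ ≤ #(powerset Q) := card_le_card (fun t ht => mem_powerset.2 (mem_powersetCard.1 ht).1)
      _ = 2 ^ #Q := card_powerset _
      _ ≤ 2 ^ 12 := Nat.pow_le_pow_right (by norm_num) hQ
      _ = 4096 := by norm_num
  have hpc' : (#(powersetCard (k+1) Q) : ℝ) ≤ 4096 := by exact_mod_cast hpc
  have h6 : (#R : ℝ) ≤ ∑ Q' ∈ powersetCard (k+1) Q, (#{b ∈ B | ∀ q ∈ Q', G.Adj q b} : ℝ) := by
    exact_mod_cast (card_le_card hsub).trans card_biUnion_le
  by_cases hne : (powersetCard (k+1) Q).Nonempty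
  · have h7 : ∑ Q' ∈ powersetCard (k+1) Q, (#{b ∈ B | ∀ q ∈ Q', G.Adj q b} : ℝ)
        < ∑ Q' ∈ powersetCard (k+1) Q, η / 4096 * #B :=
      sum_lt_sum_of_nonempty hne fun Q' hQ' => by
        rw [mem_powersetCard] at hQ'
        exact hcon Q' hQ'.1 hQ'.2
    rw [sum_const, nsmul_eq_mul] at h7
    have : (#(powersetCard (k+1) Q) : ℝ) * (η / 4096 * #B) ≤ 4096 * (η / 4096 * #B) := by gcongr
    linarith
  · rw [not_nonempty_iff_eq_empty] at hne
    rw [hne, sum_empty] at h6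
    have hBp : (0 : ℝ) < #B := by exact_mod_cast hB0
    nlinarith [mul_pos hη hBp]

lemma rt_union {a b : ℕ} {S T : Finset α} (hS : G.IsNClique a S) (hT : G.IsNClique b T)
    (h : ∀ x ∈ S, ∀ y ∈ T, G.Adj x y) : G.IsNClique (a + b) (S ∪ T) := by
  rw [SimpleGraph.isNClique_iff] at *
  constructor
  · intro x hx y hy hxy
    simp only [coe_union, Set.mem_union, mem_coe] at hx hy
    rcases hx with hx | hx <;> rcases hy with hy | hy
    · exact hS.1 hx hy hxy
    · exact h x hx y hy
    · exact (h y hy x hx).symm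
    · exact hT.1 hx hy hxy
  · rw [card_union_of_disjoint, hS.2, hT.2]
    rw [disjoint_left]
    intro x hx hx'
    exact (h x hx x hx').ne rfl

lemma rt_subclique {a : ℕ} {S T : Finset α} (hS : G.IsNClique a S) (hT : T ⊆ S) :
    G.IsNClique #T T :=
  ⟨hS.1.subset (by exact_mod_cast hT), rfl⟩

lemma rt_pair {μ η C : ℝ} (hμ : 0 < μ) (hη : 0 < η) (hη1 : η ≤ 1) (hC : C = 2 ^ 20 / η)
    (H : ∀ S : Finset α, μ ≤ #S → ∃ Q ⊆ S, G.IsNClique 12 Q) (A B : Finset α) (k : ℕ)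
    (hA : μ * C ≤ #A) (hB : μ * C ≤ #B) (hD : rtDn G μ (k / 12 + η) A B) :
    ∃ T ⊆ A ∪ B, G.IsNClique (12 + (k + 1)) T := by
  have hηC : η * C = 2 ^ 20 := by rw [hC]; field_simp
  have hC1 : 2 ^ 20 ≤ C := by rw [hC, le_div_iff₀ hη]; linarith
  have hμC : μ * 2 ^ 20 ≤ μ * C := by gcongr
  obtain ⟨A', hA', hc, hg⟩ := rt_good hμ A (fun _ : Unit => B) (fun _ => k / 12 + η) univ
    (fun _ _ => hD) (fun _ _ => by linarith)
  obtain ⟨Q, hQA, hQ⟩ := H A' (by simp at hc; linarith)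
  have hQc : #Q = 12 := hQ.2
  obtain ⟨Q', hQ'Q, hQ'c, hQ'B⟩ := rt_pigeon hη Q B k hQc.le (by omega)
    (by exact_mod_cast (show (0 : ℝ) < #B by linarith))
    (d := k / 12 + η) (by rw [hQc]; push_cast; linarith) (fun q hq => hg q (hQA hq) () (mem_univ _))
  have hsz : μ ≤ η / 4096 * #B := by
    calc μ ≤ μ * (2 ^ 20 / 4096) := by linarith
      _ = η / 4096 * (μ * C) := by rw [← hηC]; ring
      _ ≤ _ := by gcongr
  obtain ⟨R, hRB, hR⟩ := H _ (hsz.trans hQ'B)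
  have hQ'cl := rt_subclique hQ hQ'Q
  rw [hQ'c] at hQ'cl
  refine ⟨R ∪ Q', ?_, rt_union hR hQ'cl ?_⟩
  · intro x hx
    rcases mem_union.1 hx with h | h
    · exact mem_union_right _ (mem_filter.1 (hRB h)).1
    · exact mem_union_left _ (hA' (hQA (hQ'Q h)))
  · intro x hx y hy
    exact ((mem_filter.1 (hRB hx)).2 y hy).symm

lemma rt_embed {ι : Type*} [DecidableEq ι] {μ η C : ℝ} (hμ : 0 < μ) (hη : 0 < η) (hη1 : η ≤ 1)
    (hC : C = 2 ^ 20 / η)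
    (H : ∀ S : Finset α, μ ≤ #S → ∃ Q ⊆ S, G.IsNClique 12 Q) (k : ℕ) (i j : ι) (hij : i ≠ j)
    (J : Finset ι) : ∀ (V : ι → Finset α) (_ : i ∉ J) (_ : j ∉ J)
    (_ : ∀ a ∈ insert i (insert j J), μ * C ^ (#J + 1) ≤ #(V a))
    (_ : rtDn G μ (k / 12 + η) (V i) (V j))
    (_ : ∀ a ∈ insert i (insert j J), ∀ b ∈ insert i (insert j J), a ≠ b → rtDn G μ η (V a) (V b)),
    ∃ T ⊆ (insert i (insert j J)).biUnion V, G.IsNClique (12 + (k + 1) + #J) T := by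
  have hηC : η * C = 2 ^ 20 := by rw [hC]; field_simp
  have hC1 : 2 ^ 20 ≤ C := by rw [hC, le_div_iff₀ hη]; linarith
  have hC0 : 0 < C := by linarith
  induction J using Finset.induction_on with
  | empty =>
    intro V _ _ hsz hD _
    simp only [card_empty, zero_add, pow_one] at hsz
    obtain ⟨T, hT, hTc⟩ := rt_pair hμ hη hη1 hC H (V i) (V j) k (hsz i (by simp)) (hsz j (by simp)) hD
    refine ⟨T, fun x hx => ?_, by simpa using hTc⟩
    have := hT hx
    simpa using this
  | insert a J ha ih =>
    intro V hi hj hsz hD hall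
    rw [card_insert_of_notMem ha] at hsz
    have hai : a ≠ i := fun h => hi (by simp [h])
    have haj : a ≠ j := fun h => hj (by simp [h])
    have hiJ : i ∉ J := fun h => hi (by simp [h])
    have hjJ : j ∉ J := fun h => hj (by simp [h])
    set I := insert i (insert j J) with hI
    have hIc : #I = #J + 2 := by
      rw [hI, card_insert_of_notMem, card_insert_of_notMem hjJ]
      simp [hij, hiJ]
    have hII : ∀ b ∈ I, b ∈ insert i (insert j (insert a J)) := by
      intro b hb; simp only [hI, mem_insert] at hb ⊢; tauto
    have haI : a ∉ I := by simp [hI, hai, haj, ha]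
    have hamem : a ∈ insert i (insert j (insert a J)) := by simp
    have hpow : ((#J + 2 : ℕ) : ℝ) < C ^ (#J + 1 + 1) := by
      calc ((#J + 2 : ℕ) : ℝ) < 2 ^ (#J + 2) := by exact_mod_cast Nat.lt_two_pow_self
        _ ≤ C ^ (#J + 2) := by gcongr; linarith
    have hpow1 : (1 : ℝ) ≤ C ^ (#J + 1 + 1) := one_le_pow₀ (by linarith)
    obtain ⟨A', hA', hc, hg⟩ := rt_good hμ (V a) V (fun _ => η) I
      (fun b hb => hall a hamem b (hII b hb) (fun h => haI (h ▸ hb)))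
      (fun b hb => le_trans (by nlinarith) (hsz b (hII b hb)))
    have hpos : (0 : ℝ) < #A' := by
      have h1 := hsz a hamem
      rw [hIc] at hc
      nlinarith
    obtain ⟨v, hv⟩ := card_pos.1 (by exact_mod_cast hpos : 0 < #A')
    have hsub : ∀ b, {x ∈ V b | G.Adj v x} ⊆ V b := fun b => filter_subset _ _
    obtain ⟨T, hT, hTc⟩ := ih (fun b => {x ∈ V b | G.Adj v x}) hiJ hjJ
      (fun b hb => by
        refine le_trans ?_ (hg v hv b hb)
        have h1 := hsz b (hII b hb)
        have h2 : η * (μ * C ^ (#J + 1 + 1)) ≤ η * #(V b) := by gcongr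
        have h3 : η * (μ * C ^ (#J + 1 + 1)) = 2 ^ 20 * (μ * C ^ (#J + 1)) := by
          rw [← hηC]; ring
        have h4 : 0 < μ * C ^ (#J + 1) := by positivity
        linarith)
      (hD.sub (hsub _) (hsub _))
      (fun b hb c hc hbc => (hall b (hII b hb) c (hII c hc) hbc).sub (hsub _) (hsub _))
    have hvT : ∀ x ∈ T, G.Adj v x := by
      intro x hx
      obtain ⟨b, _, hxb⟩ := mem_biUnion.1 (hT hx)
      exact (mem_filter.1 hxb).2
    refine ⟨insert v T, ?_, ?_⟩
    · intro x hx
      rcases mem_insert.1 hx with rfl | hx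
      · exact mem_biUnion.2 ⟨a, hamem, hA' hv⟩
      · obtain ⟨b, hb, hxb⟩ := mem_biUnion.1 (hT hx)
        exact mem_biUnion.2 ⟨b, hII b hb, hsub b hxb⟩
    · rw [card_insert_of_notMem ha, ← add_assoc]
      exact hTc.insert hvT

lemma rt_tri {μ η C : ℝ} (hμ : 0 < μ) (hη : 0 < η) (hη1 : η ≤ 1) (hC : C = 2 ^ 20 / η)
    (H : ∀ S : Finset α, μ ≤ #S → ∃ Q ⊆ S, G.IsNClique 12 Q) (A B D : Finset α)
    (hA : μ * C ^ 2 ≤ #A) (hB : μ * C ^ 2 ≤ #B) (hD : μ * C ^ 2 ≤ #D)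
    (hAB : rtDn G μ (1 / 4 + η) A B) (hAD : rtDn G μ (1 / 4 + η) A D)
    (hBD : rtDn G μ (1 / 3 + η) B D) :
    ∃ T, G.IsNClique 19 T := by
  have hηC : η * C = 2 ^ 20 := by rw [hC]; field_simp
  have hC1 : 2 ^ 20 ≤ C := by rw [hC, le_div_iff₀ hη]; linarith
  have hμC : μ * 2 ^ 20 ≤ μ * C := by gcongr
  have hμC2 : μ * C ≤ μ * C ^ 2 := by
    rw [sq]; nlinarith
  obtain ⟨A', hA', hc, hg⟩ := rt_good hμ A (fun b : Bool => if b then B else D)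
    (fun _ => 1 / 4 + η) univ
    (fun b _ => by cases b; exacts [hAD, hAB])
    (fun b _ => by cases b <;> simp <;> linarith)
  obtain ⟨Q, hQA, hQ⟩ := H A' (by simp at hc; linarith)
  have hQc : #Q = 12 := hQ.2
  obtain ⟨Q', hQ'Q, hQ'c, hQ'B⟩ := rt_pigeon hη Q B 3 hQc.le (by omega)
    (by exact_mod_cast (show (0 : ℝ) < #B by linarith))
    (d := 1 / 4 + η) (by rw [hQc]; push_cast; linarith)
    (fun q hq => hg q (hQA hq) true (mem_univ _))
  obtain ⟨R, hRQ, hRc, hRD⟩ := rt_pigeon hη Q' D 1 (by omega) (by omega)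
    (by exact_mod_cast (show (0 : ℝ) < #D by linarith))
    (d := 1 / 4 + η) (by rw [hQ'c]; push_cast; linarith)
    (fun q hq => hg q (hQA (hQ'Q hq)) false (mem_univ _))
  have hsz : ∀ X : Finset α, μ * C ^ 2 ≤ #X → μ * C ≤ η / 4096 * #X := by
    intro X hX
    calc μ * C ≤ μ * C * (2 ^ 20 / 4096) := by nlinarith
      _ = η / 4096 * (μ * C ^ 2) := by rw [← hηC]; ring
      _ ≤ _ := by gcongr
  obtain ⟨T, hT, hTc⟩ := rt_pair hμ hη hη1 hC H {b ∈ B | ∀ q ∈ Q', G.Adj q b}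
    {b ∈ D | ∀ q ∈ R, G.Adj q b} 4 ((hsz B hB).trans hQ'B) ((hsz D hD).trans hRD)
    (by
      have : ((4 : ℕ) : ℝ) / 12 + η = 1 / 3 + η := by norm_num
      rw [this]
      exact hBD.sub (filter_subset _ _) (filter_subset _ _))
  have hRcl := rt_subclique hQ (hRQ.trans hQ'Q)
  rw [hRc] at hRcl
  refine ⟨_, rt_union hTc hRcl ?_⟩
  intro x hx y hy
  rcases mem_union.1 (hT hx) with h | h
  · exact ((mem_filter.1 h).2 y (hRQ hy)).symm
  · exact ((mem_filter.1 h).2 y hy).symm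
end

lemma rt_term {n : ℕ} (G : SimpleGraph (Fin n)) [DecidableRel G.Adj] (U V : Finset (Fin n))
    (hU : (0 : ℝ) < #U) (hV : (0 : ℝ) < #V) (η w : ℝ)
    (hw : (G.edgeDensity U V : ℝ) - 2 * η ≤ w) :
    (#(G.interedges U V) : ℝ) ≤ w * #U * #V + 2 * η * (#U * #V) := by
  have hed : (#(G.interedges U V) : ℝ) = (G.edgeDensity U V : ℝ) * (#U * #V) := by
    rw [SimpleGraph.edgeDensity_def]; push_cast; field_simp
  rw [hed]
  have := mul_le_mul_of_nonneg_right hw (mul_pos hU hV).le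
  linarith

lemma rt_core {n : ℕ} (G : SimpleGraph (Fin n)) [DecidableRel G.Adj] (P : Finpartition (univ : Finset (Fin n)))
    {μ η C ρ L : ℝ} (hμ : 0 < μ) (hη : 0 < η) (hη1 : η ≤ 1) (hC : C = 2 ^ 20 / η)
    (H : ∀ S : Finset (Fin n), μ ≤ #S → ∃ Q ⊆ S, G.IsNClique 12 Q)
    (hfree : G.CliqueFree 19) (hρη : ρ ≤ η)
    (hup : ∀ U ∈ P.parts, (#U : ℝ) * ρ ≤ μ) (hlow : ∀ U ∈ P.parts, μ * C ^ 4 ≤ #U)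
    (hL : ∀ U ∈ P.parts, (#U : ℝ) ≤ L) :
    (2 * #G.edgeFinset : ℝ) ≤ (1 / 4 + 2 * η) * n ^ 2
      + ∑ i ∈ P.nonUniforms G ρ, (#i.1 * #i.2 : ℝ) + L * n := by
  classical
  have hC1 : 2 ^ 20 ≤ C := by rw [hC, le_div_iff₀ hη]; linarith
  have hlow' : ∀ U ∈ P.parts, ∀ m ≤ 4, μ * C ^ m ≤ #U := fun U hU m hm =>
    le_trans (by gcongr; linarith) (hlow U hU)
  -- good pairs
  let gd : Finset (Fin n) → Finset (Fin n) → Prop := fun U V =>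
    U ∈ P.parts ∧ V ∈ P.parts ∧ U ≠ V ∧ G.IsUniform ρ U V
  have gsym : ∀ U V, gd U V ↔ gd V U := by
    intro U V
    simp only [gd]
    rw [SimpleGraph.isUniform_comm G, ne_comm]; tauto
  let w : Finset (Fin n) → Finset (Fin n) → ℝ := fun U V =>
    if gd U V then max 0 ((G.edgeDensity U V : ℝ) - 2 * η) else 0
  have hws : ∀ U V, w U V = w V U := by
    intro U V; simp only [w]; rw [SimpleGraph.edgeDensity_comm]; simp only [gsym U V]
  have hw0 : ∀ U, w U U = 0 := by intro U; simp [w, gd]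
  have hwn : ∀ U V, 0 ≤ w U V := by
    intro U V; simp only [w]; split_ifs
    · exact le_max_left _ _
    · exact le_rfl
  have hDn : ∀ c : ℝ, 0 ≤ c → ∀ U V, c < w U V → rtDn G μ (c + η) U V := by
    intro c hc U V h
    simp only [w] at h
    split_ifs at h with hg
    · obtain ⟨hU, hV, hUV, hu⟩ := hg
      have hd : c < (G.edgeDensity U V : ℝ) - 2 * η := by
        rcases lt_max_iff.1 h with h | h
        · linarith
        · exact h
      intro A hA B hB hAm hBm
      have := hu hA hB ((hup U hU).trans hAm) ((hup V hV).trans hBm)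
      have h2 := (abs_lt.1 this).1
      have h3 : c + η ≤ (G.edgeDensity A B : ℝ) := by linarith
      have hAp : (0 : ℝ) < #A := hμ.trans_le hAm
      have hBp : (0 : ℝ) < #B := hμ.trans_le hBm
      rw [SimpleGraph.edgeDensity_def] at h3
      push_cast at h3
      rwa [le_div_iff₀ (by positivity)] at h3
    · linarith
  have hlag := rt_lagrange w hws hw0 hwn _ P.parts rfl (fun U => (#U : ℝ)) (fun _ => by positivity)
    (by
      intro i hi j hj hij J hJ hiJ hjJ hJc hpos
      by_contra hcon
      push Not at hcon
      have hk : (((6 - #J : ℕ) : ℕ) : ℝ) = 6 - #J := by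
        rw [Nat.cast_sub (by omega)]; norm_num
      have hmem : ∀ a ∈ insert i (insert j J), a ∈ P.parts := by
        intro a ha; simp only [mem_insert] at ha
        rcases ha with rfl | rfl | h
        exacts [hi, hj, hJ h]
      obtain ⟨T, -, hT⟩ := rt_embed hμ hη hη1 hC H (6 - #J) i j hij J id hiJ hjJ
        (fun a ha => hlow' a (hmem a ha) _ (by omega))
        (hDn _ (by positivity) i j (by rw [hk]; exact hcon))
        (fun a ha b hb hab => by
          have := hDn 0 le_rfl a b (hpos a ha b hb hab)
          rwa [zero_add] at this)
      have e : 12 + (6 - #J + 1) + #J = 19 := by omega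
      rw [e] at hT
      exact hfree T hT)
    (by
      intro i hi j hj k hk hij hik hjk h1 h2 h3
      obtain ⟨T, hT⟩ := rt_tri hμ hη hη1 hC H k i j (hlow' k hk 2 (by norm_num))
        (hlow' i hi 2 (by norm_num)) (hlow' j hj 2 (by norm_num))
        (hDn _ (by norm_num) k i (by rwa [hws])) (hDn _ (by norm_num) k j (by rwa [hws]))
        (hDn _ (by norm_num) i j h1)
      exact hfree T hT)
  have hsum : ∑ U ∈ P.parts, (#U : ℝ) = n := by
    have := P.sum_card_parts
    rw [card_univ, Fintype.card_fin] at this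
    exact_mod_cast this
  rw [hsum] at hlag
  have he : (2 * #G.edgeFinset : ℝ) = ∑ U ∈ P.parts, ∑ V ∈ P.parts, (#(G.interedges U V) : ℝ) := by
    have h1 : 2 * #G.edgeFinset = #(G.interedges univ univ) := by
      rw [SimpleGraph.two_mul_card_edgeFinset]
      rfl
    have h2 := Rel.card_interedges_finpartition (r := G.Adj) P P
    rw [sum_product] at h2
    have h3 : 2 * #G.edgeFinset = ∑ U ∈ P.parts, ∑ V ∈ P.parts, #(G.interedges U V) := h1.trans h2
    exact_mod_cast h3
  have hterm : ∀ U ∈ P.parts, ∀ V ∈ P.parts, (#(G.interedges U V) : ℝ) ≤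
      w U V * #U * #V + 2 * η * (#U * #V) + (if (U, V) ∈ P.nonUniforms G ρ then (#U * #V : ℝ) else 0)
       + (if U = V then L * #U else 0) := by
    intro U hU V hV
    have hle : (#(G.interedges U V) : ℝ) ≤ #U * #V := by
      exact_mod_cast Rel.card_interedges_le_mul (r := G.Adj) U V
    have p1 : 0 ≤ w U V * #U * #V := by have := hwn U V; positivity
    have p2 : 0 ≤ 2 * η * (#U * #V : ℝ) := by positivity
    have hUL := hL U hU
    have pL : (0 : ℝ) ≤ L * #U := mul_nonneg (le_trans (by positivity) hUL) (by positivity)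
    have p3 : (0 : ℝ) ≤ if (U, V) ∈ P.nonUniforms G ρ then (#U * #V : ℝ) else 0 := by
      split_ifs <;> positivity
    by_cases hUV : U = V
    · rw [if_pos hUV]
      subst hUV
      have : (#U * #U : ℝ) ≤ L * #U := by gcongr
      linarith
    · rw [if_neg hUV]
      by_cases hn : (U, V) ∈ P.nonUniforms G ρ
      · rw [if_pos hn]; linarith
      · rw [if_neg hn]
        have hu : G.IsUniform ρ U V := by
          by_contra h
          exact hn ((Finpartition.mk_mem_nonUniforms ..).2 ⟨hU, hV, hUV, h⟩)
        have hwd : (G.edgeDensity U V : ℝ) - 2 * η ≤ w U V := by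
          simp only [w]
          rw [if_pos ⟨hU, hV, hUV, hu⟩]
          exact le_max_right _ _
        have hC4 : 0 < μ * C ^ 4 := by
          have : 0 < C := by linarith
          positivity
        have hUp : (0 : ℝ) < #U := hC4.trans_le (hlow U hU)
        have hVp : (0 : ℝ) < #V := hC4.trans_le (hlow V hV)
        have := rt_term G U V hUp hVp η (w U V) hwd
        rw [add_zero, add_zero]; exact this
  rw [he]
  refine (sum_le_sum fun U hU => sum_le_sum fun V hV => hterm U hU V hV).trans ?_
  simp only [sum_add_distrib]
  have t1 : ∑ U ∈ P.parts, ∑ V ∈ P.parts, w U V * #U * #V ≤ 1 / 4 * (n : ℝ) ^ 2 := hlag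
  have t2 : ∑ U ∈ P.parts, ∑ V ∈ P.parts, 2 * η * (#U * #V : ℝ) = 2 * η * n ^ 2 := by
    simp_rw [← mul_sum]
    rw [← sum_mul, hsum]; ring
  have t3 : ∑ U ∈ P.parts, ∑ V ∈ P.parts, (if (U, V) ∈ P.nonUniforms G ρ then (#U * #V : ℝ) else 0)
      = ∑ i ∈ P.nonUniforms G ρ, (#i.1 * #i.2 : ℝ) := by
    rw [← sum_product', ← sum_filter (fun p : Finset (Fin n) × Finset (Fin n) => (p.1, p.2) ∈ P.nonUniforms G ρ)
      (fun p => (#p.1 * #p.2 : ℝ))]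
    refine sum_congr ?_ fun _ _ => rfl
    ext ⟨U, V⟩
    simp only [mem_filter, mem_product, Finpartition.mk_mem_nonUniforms]
    tauto
  have t4 : ∑ U ∈ P.parts, ∑ V ∈ P.parts, (if U = V then L * #U else 0) = L * n := by
    rw [← hsum, mul_sum]
    refine sum_congr rfl fun U hU => ?_
    rw [sum_ite_eq, if_pos hU]
  rw [t2, t3, t4]
  linarith

/-- **Proposition.** `θ₁₂(K₁₉) ≤ 1/8`: for every `δ > 0` there are `ε > 0`
and `n₀` such that for all `n ≥ n₀`, every `K₁₉`-free graph `G` on `n`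
vertices with `α₁₂(G) ≤ ε·n` has at most `(1/8 + δ)·n²` edges. -/
theorem theta_twelve_K_nineteen (δ : ℝ) (hδ : 0 < δ) :
    ∃ ε : ℝ, 0 < ε ∧ ∃ n₀ : ℕ, ∀ n : ℕ, n₀ ≤ n →
      ∀ G : SimpleGraph (Fin n),
        G.CliqueFree 19 →
        (∀ S : Finset (Fin n), (G.induce (S : Set (Fin n))).CliqueFree 12 →
          (S.card : ℝ) ≤ ε * n) →
        (G.edgeSet.ncard : ℝ) ≤ (1 / 8 + δ) * n ^ 2 := by
  classical
  obtain ⟨η, hη, hη1, hηδ⟩ : ∃ η : ℝ, 0 < η ∧ η ≤ 1 ∧ η ≤ δ / 4 :=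
    ⟨min 1 (δ / 4), by positivity, min_le_left _ _, min_le_right _ _⟩
  obtain ⟨C, hC⟩ : ∃ C : ℝ, C = 2 ^ 20 / η := ⟨_, rfl⟩
  have hηC : η * C = 2 ^ 20 := by rw [hC]; field_simp
  have hC1 : 2 ^ 20 ≤ C := by rw [hC, le_div_iff₀ hη]; linarith
  have hC0 : 0 < C := by linarith
  obtain ⟨ρ, hρ⟩ : ∃ ρ : ℝ, ρ = 1 / (2 * C ^ 4) := ⟨_, rfl⟩
  have hρ0 : 0 < ρ := by rw [hρ]; positivity
  have hρη : ρ ≤ η / 4 := by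
    rw [hρ, div_le_iff₀ (by positivity)]
    have : 1 ≤ C ^ 3 := one_le_pow₀ (by linarith)
    have e : η / 4 * (2 * C ^ 4) = 2 ^ 19 * C ^ 3 := by
      have : η / 4 * (2 * C ^ 4) = (η * C) * C ^ 3 / 2 := by ring
      rw [this, hηC]; ring
    rw [e]; linarith
  obtain ⟨l, hl⟩ := exists_nat_ge (4 / δ + 1)
  have hl1 : (1 : ℝ) ≤ l := le_trans (by have : 0 < 4 / δ := by positivity
                                         linarith) hl
  set K := SzemerediRegularity.bound ρ l with hK
  have hK0 : 0 < K := SzemerediRegularity.bound_pos _ _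
  have hKr : (0 : ℝ) < K := by exact_mod_cast hK0
  refine ⟨ρ / (2 * K), by positivity, K + l, ?_⟩
  intro n hn G hfree hα
  have hn0 : 0 < n := by omega
  have hnr : (0 : ℝ) < n := by exact_mod_cast hn0
  obtain ⟨P, hP1, hP2, hP3, hP4⟩ := szemeredi_regularity G hρ0 (l := l) (by simp; omega)
  set k := #P.parts with hk
  have hkn : k ≤ n := by omega
  have hl1' : 1 ≤ l := by exact_mod_cast hl1
  have hk0 : 0 < k := by omega
  have hkr : (0 : ℝ) < k := by exact_mod_cast hk0
  set q := n / k with hq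
  have hq1 : 1 ≤ q := (Nat.one_le_div_iff hk0).2 hkn
  have hqr : (1 : ℝ) ≤ q := by exact_mod_cast hq1
  have hqn : (q : ℝ) * k ≤ n := by exact_mod_cast Nat.div_mul_le_self n k
  have hnq : (n : ℝ) ≤ 2 * q * K := by
    have h1 : n < k * (q + 1) := by
      have := Nat.lt_mul_div_succ n hk0
      exact this
    have h2 : k * (q + 1) ≤ K * (2 * q) := Nat.mul_le_mul hP3 (by omega)
    have h3 : n ≤ K * (2 * q) := by omega
    have h4 : (n : ℝ) ≤ K * (2 * q) := by exact_mod_cast h3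
    linarith
  have hlowq : ∀ U ∈ P.parts, (q : ℝ) ≤ #U := fun U hU => by
    have := hP1.average_le_card_part hU
    rw [card_univ, Fintype.card_fin] at this
    exact_mod_cast this
  have hupq : ∀ U ∈ P.parts, (#U : ℝ) ≤ 2 * q := fun U hU => by
    have := hP1.card_part_le_average_add_one hU
    rw [card_univ, Fintype.card_fin] at this
    have h2 : #U ≤ 2 * q := by rw [← hk, ← hq] at this; omega
    exact_mod_cast h2
  have hcore := rt_core G P (μ := 2 * q * ρ) (η := η) (C := C) (ρ := ρ) (L := 2 * q)
    (by positivity) hη hη1 hC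
    (by
      intro S hS
      by_contra hno
      push Not at hno
      have := hα S (by
        rw [SimpleGraph.cliqueFree_induce_iff]
        intro t ht hc
        exact hno t (by exact_mod_cast ht) hc)
      have h2 : ρ / (2 * K) * n ≤ ρ / (2 * K) * (2 * q * K) := by gcongr
      have h3 : ρ / (2 * K) * (2 * q * K) = q * ρ := by field_simp
      have : 0 < q * ρ := by positivity
      linarith)
    hfree (by linarith) (fun U hU => by have := hupq U hU; gcongr)
    (fun U hU => by
      refine le_trans (le_of_eq ?_) (hlowq U hU)
      rw [hρ]; field_simp)
    hupq
  have hnu := hP1.sum_nonUniforms_lt' (G := G) ⟨⟨0, hn0⟩, mem_univ _⟩ hρ0 hP4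
  rw [card_univ, Fintype.card_fin] at hnu
  have hnu2 : ρ * ((n : ℝ) + k) ^ 2 ≤ δ / 16 * (4 * n ^ 2) := by
    have h1 : (k : ℝ) ≤ n := by exact_mod_cast hkn
    calc ρ * ((n : ℝ) + k) ^ 2 ≤ δ / 16 * ((n : ℝ) + n) ^ 2 := by gcongr; linarith
      _ = _ := by ring
  have hLn : 2 * (q : ℝ) * n ≤ δ / 2 * n ^ 2 := by
    have h1 : (4 / δ : ℝ) ≤ k := by
      have : (l : ℝ) ≤ k := by exact_mod_cast hP2
      linarith
    have h2 : q * (4 / δ) ≤ n := le_trans (by gcongr) hqn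
    have h3 : 2 * (q : ℝ) ≤ δ / 2 * n := by
      have h4 := mul_le_mul_of_nonneg_left h2 (by positivity : 0 ≤ δ / 2)
      have h5 : δ / 2 * (q * (4 / δ)) = 2 * q := by field_simp; ring
      linarith
    calc 2 * (q : ℝ) * n ≤ (δ / 2 * n) * n := by gcongr
      _ = _ := by ring
  have hee : (G.edgeSet.ncard : ℝ) = #G.edgeFinset := by
    rw [← SimpleGraph.coe_edgeFinset, Set.ncard_coe_finset]
  rw [hee]
  have hη2 : η * (n : ℝ) ^ 2 ≤ δ / 4 * n ^ 2 := by gcongr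
  have hd2 : 0 ≤ δ * (n : ℝ) ^ 2 := by positivity
  linarith
end

section
/- Let r ≥ 2 be an integer, let V be a finite set, let ℋ be an r-uniform hypergraph on V (a collection of r-element subsets of V), let 0 < γ < 1, and let k be a positive integer. Then there exist a positive integer t and an r-uniform hypergraph 𝒢 on the vertex set V × {1, …, t} with the following two properties. (i) For every hyperedge {a₁, …, a_r} ∈ ℋ and every choice of sets U_i ⊆ {a_i} × {1, …, t} with |U_i| ≥ γt for each 1 ≤ i ≤ r, there is at least one hyperedge of 𝒢 containing one vertex from each U_i. (ii) For every nonempty collection S of hyperedges of 𝒢, writing m = |S| and v = |⋃_{F ∈ S} F| for the number of vertices spanned by S, if v ≤ k then v + (1 + γ − r)(m − 1) ≥ r (i.e., 𝒢 contains no v-vertex subhypergraph with m edges where v ≤ k and v + (1 + γ − r)(m − 1) < r). -/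
open Filter Topology in
lemma rb_asym (n r : ℕ) (hr : 2 ≤ r) (hn : 0 < n) (γ q ε : ℝ) (hγ0 : 0 < γ) (hq : 0 < q) (hε : 0 < ε)
    (P : Finset (ℕ × ℕ)) (hP : ∀ p ∈ P, 1 ≤ p.1 ∧ (p.2 : ℝ) + (1 + γ - r) * ((p.1 : ℝ) - 1) < r) :
    ∃ t N : ℕ, 0 < t ∧
      (∀ p ∈ P, (N : ℝ) ^ p.1 * ((n * t : ℕ) : ℝ) ^ p.2 * (p.2 : ℝ) ^ (r * p.1)
        ≤ ε * N * ((n * t : ℕ) : ℝ) ^ (r * p.1)) ∧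
      ((n * t : ℕ) : ℝ) * r + 1 < q * N / 4 := by
  have h1 : ∀ p ∈ P, ∀ᶠ t : ℕ in atTop,
      ((n : ℝ) ^ p.2 * (p.2 : ℝ) ^ (r * p.1)) *
        (t : ℝ) ^ ((1 + γ) * ((p.1 : ℝ) - 1) + p.2 - r * p.1) ≤ ε := by
    intro p hp
    obtain ⟨h1, h2⟩ := hP p hp
    have hneg : 0 < -((1 + γ) * ((p.1 : ℝ) - 1) + p.2 - r * p.1) := by nlinarith
    have := ((tendsto_rpow_neg_atTop hneg).comp (tendsto_natCast_atTop_atTop (R := ℝ))).const_mul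
      ((n : ℝ) ^ p.2 * (p.2 : ℝ) ^ (r * p.1))
    simp only [neg_neg, mul_zero] at this
    exact (this.eventually (ge_mem_nhds hε))
  have h2 : ∀ᶠ t : ℕ in atTop, ((n : ℝ) * r + 1 + q / 4) * (4 / q) + 1 ≤ (t : ℝ) ^ γ :=
    ((tendsto_rpow_atTop hγ0).comp (tendsto_natCast_atTop_atTop (R := ℝ))).eventually
      (eventually_ge_atTop _)
  obtain ⟨t, ht1, ht2, ht3⟩ := (((eventually_all_finset P).2 h1).and
    (h2.and (eventually_ge_atTop 1))).exists
  have htp : (1 : ℝ) ≤ t := by exact_mod_cast ht3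
  have ht0 : (0 : ℝ) < t := by linarith
  refine ⟨t, ⌊(t : ℝ) ^ (1 + γ)⌋₊, ht3, ?_, ?_⟩
  · intro p hp
    have h3 := ht1 p hp
    obtain ⟨hp1, -⟩ := hP p hp
    obtain ⟨m, hm⟩ : ∃ m, p.1 = m + 1 := ⟨p.1 - 1, by omega⟩
    have hN : ((⌊(t : ℝ) ^ (1 + γ)⌋₊ : ℕ) : ℝ) ≤ (t : ℝ) ^ (1 + γ) :=
      Nat.floor_le (by positivity)
    set N : ℝ := ((⌊(t : ℝ) ^ (1 + γ)⌋₊ : ℕ) : ℝ)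
    have hN0 : 0 ≤ N := Nat.cast_nonneg _
    have hNm : N ^ m ≤ (t : ℝ) ^ ((1 + γ) * m) := by
      rw [Real.rpow_mul_natCast ht0.le]
      exact pow_le_pow_left₀ hN0 hN m
    have he : (t : ℝ) ^ ((1 + γ) * ((p.1 : ℝ) - 1) + p.2 - r * p.1) =
        (t : ℝ) ^ ((1 + γ) * m) * (t : ℝ) ^ p.2 / (t : ℝ) ^ (r * p.1) := by
      rw [Real.rpow_sub ht0, Real.rpow_add ht0, Real.rpow_natCast, ← Nat.cast_mul,
        Real.rpow_natCast, hm]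
      congr 4
      push_cast; ring
    rw [he] at h3
    have h4 : (n : ℝ) ^ p.2 * (p.2 : ℝ) ^ (r * p.1) * (N ^ m * (t : ℝ) ^ p.2)
        ≤ ε * (t : ℝ) ^ (r * p.1) := by
      rw [mul_div_assoc', div_le_iff₀ (by positivity)] at h3
      refine le_trans ?_ h3
      gcongr
    have h5 : (1 : ℝ) ≤ (n : ℝ) ^ (r * p.1) := one_le_pow₀ (by exact_mod_cast hn)
    have h6 : ε * (t : ℝ) ^ (r * p.1) ≤ ε * ((n * t : ℕ) : ℝ) ^ (r * p.1) := by
      push_cast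
      rw [mul_pow]
      have : 0 ≤ (t : ℝ) ^ (r * p.1) := by positivity
      gcongr
      nlinarith
    calc N ^ p.1 * ((n * t : ℕ) : ℝ) ^ p.2 * (p.2 : ℝ) ^ (r * p.1)
        = N * ((n : ℝ) ^ p.2 * (p.2 : ℝ) ^ (r * p.1) * (N ^ m * (t : ℝ) ^ p.2)) := by
          rw [show N ^ p.1 = N ^ (m + 1) by rw [hm]]; push_cast; ring
      _ ≤ N * (ε * ((n * t : ℕ) : ℝ) ^ (r * p.1)) := by
          exact mul_le_mul_of_nonneg_left (h4.trans h6) hN0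
      _ = _ := by ring
  · have hN := Nat.lt_floor_add_one ((t : ℝ) ^ (1 + γ))
    rw [Real.rpow_add ht0, Real.rpow_one] at hN
    rw [Real.rpow_add ht0, Real.rpow_one]
    set N : ℝ := ((⌊(t : ℝ) * (t : ℝ) ^ γ⌋₊ : ℕ) : ℝ)
    push_cast
    have h3 : ((n : ℝ) * r + 1 + q / 4) + q / 4 ≤ q / 4 * (t : ℝ) ^ γ := by
      have := mul_le_mul_of_nonneg_left ht2 (by positivity : 0 ≤ q / 4)
      refine le_trans (le_of_eq ?_) this
      field_simp
    have h4 := mul_le_mul_of_nonneg_left h3 ht0.le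
    nlinarith

open Finset in
lemma rb_pair {Ω : Type*} [Fintype Ω] [DecidableEq Ω] (N : ℕ) (I : Finset (Fin N)) (A : Finset Ω) :
    (#{f : Fin N → Ω | ∀ i ∈ I, f i ∈ A}) * Fintype.card Ω ^ #I = #A ^ #I * Fintype.card Ω ^ N := by
  have h : ({f : Fin N → Ω | ∀ i ∈ I, f i ∈ A} : Finset _) =
      Fintype.piFinset (fun i => if i ∈ I then A else univ) := by
    ext f
    simp only [mem_filter, mem_univ, true_and, Fintype.mem_piFinset]
    refine forall_congr' fun i => ?_
    split_ifs with h <;> simp [h]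
  rw [h, Fintype.card_piFinset]
  simp only [apply_ite card, card_univ]
  rw [prod_ite, prod_const, prod_const, mul_assoc, ← pow_add]
  congr 3
  · simp
  · have := card_filter_add_card_filter_not (s := (univ : Finset (Fin N))) (fun i => i ∈ I)
    simp only [card_univ, Fintype.card_fin, filter_mem_eq_inter, univ_inter] at this
    simp only [← this]; omega

open Finset in
lemma rb_chernoff {Ω : Type*} [Fintype Ω] [DecidableEq Ω] (N : ℕ) (A : Finset Ω) (q : ℝ)
    (hA : q * Fintype.card Ω ≤ #A) :
    ∑ f : Fin N → Ω, (1 / 2 : ℝ) ^ #{i | f i ∈ A} ≤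
      (Fintype.card Ω : ℝ) ^ N * Real.exp (- (q * N / 2)) := by
  have h1 : ∀ f : Fin N → Ω, (1 / 2 : ℝ) ^ #{i | f i ∈ A} =
      ∏ i, (if f i ∈ A then (1 / 2 : ℝ) else 1) := by
    intro f
    rw [prod_ite]; simp
  simp only [h1]
  rw [← Fintype.piFinset_univ, ← Finset.prod_univ_sum (fun _ => univ)
    (fun _ ω => if ω ∈ A then (1 / 2 : ℝ) else 1)]
  rw [prod_const, card_univ, Fintype.card_fin]
  have h2 : ∑ ω : Ω, (if ω ∈ A then (1 / 2 : ℝ) else 1) = Fintype.card Ω - #A / 2 := by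
    have : ∀ ω : Ω, (if ω ∈ A then (1 / 2 : ℝ) else 1) = 1 - (if ω ∈ A then 1 / 2 else 0) := by
      intro ω; split_ifs <;> norm_num
    simp only [this, sum_sub_distrib, sum_ite_mem, univ_inter, sum_const, card_univ, nsmul_eq_mul]
    ring
  rw [h2, show -(q * N / 2) = N * (-(q / 2)) by ring, Real.exp_nat_mul, ← mul_pow]
  have h3 : (#A : ℝ) ≤ Fintype.card Ω := by exact_mod_cast card_le_univ A
  apply pow_le_pow_left₀
  · have : (0:ℝ) ≤ #A := by positivity
    linarith
  · have := Real.add_one_le_exp (-(q / 2))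
    have h4 : (0:ℝ) ≤ Fintype.card Ω := by positivity
    nlinarith

/-- The pairs `(I, T)` of indices and vertices witnessing a dense configuration. -/
def rbBad {W : Type*} [Fintype W] [DecidableEq W] {r N : ℕ} (P : Finset (ℕ × ℕ))
    (f : Fin N → Fin r → W) : Finset (Finset (Fin N) × Finset W) :=
  {x | (x.1.card, x.2.card) ∈ P ∧ ∀ i ∈ x.1, f i ∈ Fintype.piFinset (fun _ => x.2)}

open Finset in
lemma rb_bad_sum {W : Type*} [Fintype W] [DecidableEq W] (r N : ℕ) (ε : ℝ)
    (P : Finset (ℕ × ℕ)) (hM : 0 < Fintype.card W)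
    (hP : ∀ p ∈ P, (N : ℝ) ^ p.1 * (Fintype.card W : ℝ) ^ p.2 * (p.2 : ℝ) ^ (r * p.1)
        ≤ ε * N * (Fintype.card W : ℝ) ^ (r * p.1)) :
    ∑ f : Fin N → Fin r → W, (#(rbBad P f) : ℝ) ≤
      #P * (ε * N * (Fintype.card (Fin r → W) : ℝ) ^ N) := by
  have hsplit : ∀ f : Fin N → Fin r → W, (#(rbBad P f) : ℝ) =
      ∑ p ∈ P, ∑ I ∈ powersetCard p.1 (univ : Finset (Fin N)),
        ∑ T ∈ powersetCard p.2 (univ : Finset W),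
          if ∀ i ∈ I, f i ∈ Fintype.piFinset (fun _ => T) then (1 : ℝ) else 0 := by
    intro f
    rw [card_eq_sum_card_fiberwise (f := fun x => (#x.1, #x.2)) (t := P)]
    · push_cast
      refine sum_congr rfl fun p hp => ?_
      rw [← sum_product', ← sum_filter, sum_const, nsmul_eq_mul, mul_one]
      congr 2
      ext x
      simp only [rbBad, mem_filter, mem_univ, true_and, mem_product, mem_powersetCard,
        subset_univ]
      constructor
      · rintro ⟨⟨h1, h2⟩, h3⟩
        simp only [← h3]; exact ⟨⟨trivial, trivial⟩, h2⟩
      · rintro ⟨⟨h1, h2⟩, h3⟩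
        rw [h1, h2]; exact ⟨⟨hp, h3⟩, rfl⟩
    · intro x hx
      simp only [rbBad, coe_filter, mem_univ, true_and, Set.mem_ofPred_eq] at hx
      exact hx.1
  simp only [hsplit]
  rw [sum_comm, ← nsmul_eq_mul]
  apply sum_le_card_nsmul
  intro p hp
  rw [sum_comm]
  have hM' : (0 : ℝ) < Fintype.card W := by exact_mod_cast hM
  have hΩ : (Fintype.card (Fin r → W) : ℝ) = (Fintype.card W : ℝ) ^ r := by simp
  have h1 : ∀ I ∈ powersetCard p.1 (univ : Finset (Fin N)),
      ∑ f : Fin N → Fin r → W, ∑ T ∈ powersetCard p.2 (univ : Finset W),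
          (if ∀ i ∈ I, f i ∈ Fintype.piFinset (fun _ => T) then (1 : ℝ) else 0)
      ≤ (Fintype.card W : ℝ) ^ p.2 * ((p.2 : ℝ) ^ (r * p.1) *
        (Fintype.card (Fin r → W) : ℝ) ^ N / (Fintype.card W : ℝ) ^ (r * p.1)) := by
    intro I hI
    rw [sum_comm]
    have h2 : ∀ T ∈ powersetCard p.2 (univ : Finset W), ∑ f : Fin N → Fin r → W,
          (if ∀ i ∈ I, f i ∈ Fintype.piFinset (fun _ => T) then (1 : ℝ) else 0) ≤
          ((p.2 : ℝ) ^ (r * p.1) *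
        (Fintype.card (Fin r → W) : ℝ) ^ N / (Fintype.card W : ℝ) ^ (r * p.1)) := by
      intro T hT
      rw [mem_powersetCard] at hT hI
      rw [← sum_filter, sum_const, nsmul_eq_mul, mul_one, le_div_iff₀ (by positivity)]
      have := rb_pair N I (Fintype.piFinset (fun _ : Fin r => T))
      rw [Fintype.card_piFinset_const, hI.2, hT.2] at this
      have h3 : ((_ : ℕ) : ℝ) = _ := congrArg (Nat.cast : ℕ → ℝ) this
      push_cast at h3
      rw [pow_mul, pow_mul]
      apply le_of_eq
      simpa using h3
    refine (sum_le_card_nsmul _ _ _ h2).trans ?_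
    rw [nsmul_eq_mul]
    gcongr
    rw [card_powersetCard, card_univ]
    exact_mod_cast Nat.choose_le_pow _ _
  refine (sum_le_card_nsmul _ _ _ h1).trans ?_
  rw [nsmul_eq_mul, card_powersetCard, card_univ, Fintype.card_fin]
  have h4 : ((N.choose p.1 : ℕ) : ℝ) ≤ (N : ℝ) ^ p.1 := by
    exact_mod_cast Nat.choose_le_pow _ _
  calc _ ≤ (N : ℝ) ^ p.1 * ((Fintype.card W : ℝ) ^ p.2 * ((p.2 : ℝ) ^ (r * p.1) *
        (Fintype.card (Fin r → W) : ℝ) ^ N / (Fintype.card W : ℝ) ^ (r * p.1))) := by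
        gcongr
    _ = ((N : ℝ) ^ p.1 * (Fintype.card W : ℝ) ^ p.2 * (p.2 : ℝ) ^ (r * p.1)) *
        (Fintype.card (Fin r → W) : ℝ) ^ N / (Fintype.card W : ℝ) ^ (r * p.1) := by ring
    _ ≤ (ε * N * (Fintype.card W : ℝ) ^ (r * p.1)) *
        (Fintype.card (Fin r → W) : ℝ) ^ N / (Fintype.card W : ℝ) ^ (r * p.1) := by
        have := hP p hp
        exact div_le_div_of_nonneg_right (mul_le_mul_of_nonneg_right this (by positivity)) (by positivity)
    _ = _ := by field_simp

open Finset in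
lemma rb_good {W : Type*} [Fintype W] [DecidableEq W] (r N : ℕ) (q ε : ℝ) (hq : 0 < q)
    (P : Finset (ℕ × ℕ)) (hM : 0 < Fintype.card W) (hε : #P * ε ≤ q / 8)
    (hP : ∀ p ∈ P, (N : ℝ) ^ p.1 * (Fintype.card W : ℝ) ^ p.2 * (p.2 : ℝ) ^ (r * p.1)
        ≤ ε * N * (Fintype.card W : ℝ) ^ (r * p.1))
    (hs : (Fintype.card W : ℝ) * r + 1 < q * N / 4) :
    ∃ f : Fin N → Fin r → W, (#(rbBad P f) : ℝ) < q * N / 4 ∧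
      ∀ A : Fin r → Finset W, q * (Fintype.card W : ℝ) ^ r ≤ #(Fintype.piFinset A) →
        q * N / 4 < #{i | f i ∈ Fintype.piFinset A} := by
  by_contra! hcon
  set b := q * N / 4 with hb
  have hb0 : 0 < b := by
    have : (0 : ℝ) ≤ (Fintype.card W : ℝ) * r := by positivity
    linarith
  have hΩ : (Fintype.card (Fin r → W) : ℝ) = (Fintype.card W : ℝ) ^ r := by simp
  have hΩ0 : (0 : ℝ) < Fintype.card (Fin r → W) := by rw [hΩ]; positivity
  let G : Finset (Fin r → Finset W) :=
    {A | q * (Fintype.card W : ℝ) ^ r ≤ #(Fintype.piFinset A)}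
  have h1 : ∀ f : Fin N → Fin r → W, (1 : ℝ) ≤ #(rbBad P f) / b +
      ∑ A ∈ G, Real.exp b * (1 / 2 : ℝ) ^ #{i | f i ∈ Fintype.piFinset A} := by
    intro f
    by_cases hX : (#(rbBad P f) : ℝ) < b
    · obtain ⟨A, hA, hA2⟩ := hcon f hX
      have h2 : (1 : ℝ) ≤ Real.exp b * (1 / 2 : ℝ) ^ #{i | f i ∈ Fintype.piFinset A} := by
        set h := #{i | f i ∈ Fintype.piFinset A}
        have h3 : Real.exp (-1) ≤ 1 / 2 := by
          rw [Real.exp_neg, ← one_div]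
          apply one_div_le_one_div_of_le (by norm_num)
          have := Real.add_one_le_exp (1 : ℝ)
          linarith
        have h4 : Real.exp (-b) ≤ (1 / 2 : ℝ) ^ h := by
          calc Real.exp (-b) ≤ Real.exp (h * (-1)) := by
                apply Real.exp_le_exp.2; linarith
            _ = Real.exp (-1) ^ h := Real.exp_nat_mul _ _
            _ ≤ _ := pow_le_pow_left₀ (Real.exp_pos _).le h3 _
        calc (1 : ℝ) = Real.exp b * Real.exp (-b) := by rw [← Real.exp_add]; simp
          _ ≤ _ := by gcongr
      have h5 := single_le_sum (s := G) (f := fun A => Real.exp b *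
        (1 / 2 : ℝ) ^ #{i | f i ∈ Fintype.piFinset A}) (fun _ _ => by positivity)
        (show A ∈ G by simpa [G] using hA)
      have h6 : (0 : ℝ) ≤ #(rbBad P f) / b := by positivity
      linarith
    · push Not at hX
      have h6 : (1 : ℝ) ≤ #(rbBad P f) / b := by rwa [one_le_div hb0]
      have h7 : 0 ≤ ∑ A ∈ G, Real.exp b * (1 / 2 : ℝ) ^ #{i | f i ∈ Fintype.piFinset A} :=
        sum_nonneg fun _ _ => by positivity
      linarith
  have h2 := sum_le_sum (s := univ) (fun f _ => h1 f)
  rw [sum_add_distrib, ← sum_div, sum_comm] at h2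
  simp only [sum_const, card_univ, nsmul_eq_mul, mul_one, ← mul_sum] at h2
  have h3 := rb_bad_sum r N ε P hM hP
  have hK : (Fintype.card (Fin N → Fin r → W) : ℝ) = (Fintype.card (Fin r → W) : ℝ) ^ N := by
    rw [Fintype.card_fun, Fintype.card_fin]; push_cast; rfl
  rw [hK] at h2
  set K := (Fintype.card (Fin r → W) : ℝ) ^ N with hKdef
  have hK0 : 0 < K := by positivity
  have h4 : (∑ f : Fin N → Fin r → W, (#(rbBad P f) : ℝ)) / b ≤ K / 2 := by
    rw [div_le_iff₀ hb0]
    refine h3.trans ?_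
    have : 0 ≤ N * K := by positivity
    rw [hb]
    nlinarith
  have h5 : ∑ A ∈ G, (∑ f : Fin N → Fin r → W, (1 / 2 : ℝ) ^ #{i | f i ∈ Fintype.piFinset A})
      ≤ Real.exp (Fintype.card W * r) * (K * Real.exp (-(q * N / 2))) := by
    refine (sum_le_card_nsmul _ _ (K * Real.exp (-(q * N / 2))) ?_).trans ?_
    · intro A hA
      apply rb_chernoff
      rw [hΩ]
      simpa [G] using hA
    · rw [nsmul_eq_mul]
      gcongr
      calc (#G : ℝ) ≤ (Fintype.card (Fin r → Finset W) : ℝ) := by exact_mod_cast card_le_univ G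
        _ = 2 ^ (Fintype.card W * r) := by simp [pow_mul]
        _ ≤ Real.exp 1 ^ (Fintype.card W * r) := by
          apply pow_le_pow_left₀ (by norm_num)
          have := Real.add_one_le_exp (1 : ℝ)
          linarith
        _ = _ := by rw [← Real.exp_nat_mul]; push_cast; simp
  have h6 : Real.exp b * (Real.exp (Fintype.card W * r) * (K * Real.exp (-(q * N / 2))))
      < K / 2 := by
    have : Real.exp b * (Real.exp (Fintype.card W * r) * (K * Real.exp (-(q * N / 2)))) =
        K * Real.exp (b + Fintype.card W * r + -(q * N / 2)) := by
      rw [Real.exp_add, Real.exp_add]; ring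
    rw [this]
    have h7 : Real.exp (b + Fintype.card W * r + -(q * N / 2)) < Real.exp (-1) := by
      apply Real.exp_lt_exp.2; linarith
    have h8 : Real.exp (-1) ≤ 1 / 2 := by
      rw [Real.exp_neg, ← one_div]
      apply one_div_le_one_div_of_le (by norm_num)
      have := Real.add_one_le_exp (1 : ℝ)
      linarith
    nlinarith
  have h9 := mul_le_mul_of_nonneg_left h5 (Real.exp_pos b).le
  linarith


/-- **Theorem (random blow-up of a hypergraph; Theorem 16 in [BL]).**
Let `ℋ` be an `r`-uniform hypergraph on a finite vertex set `V`, let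
`0 < γ < 1` and let `k` be a positive integer. Then there are `t ≥ 1` and an
`r`-uniform hypergraph `𝒢` on `V × {1,…,t}` such that:
(i) for every hyperedge `E = {a₁,…,a_r} ∈ ℋ` and all sets
`U_i ⊆ {a_i} × [t]` with `|U_i| ≥ γ·t`, some hyperedge of `𝒢` meets every
`U_i`; and
(ii) every nonempty collection `S` of `m` hyperedges of `𝒢` spanning
`v ≤ k` vertices satisfies `v + (1 + γ - r)(m - 1) ≥ r`. -/
theorem random_blowup_hypergraph
    {V : Type*} [Fintype V] [DecidableEq V]
    (r k : ℕ) (hr : 2 ≤ r) (hk : 0 < k)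
    (γ : ℝ) (hγ0 : 0 < γ) (hγ1 : γ < 1)
    (ℋ : Finset (Finset V)) (hunif : ∀ E ∈ ℋ, E.card = r) :
    ∃ t : ℕ, 0 < t ∧
      ∃ 𝒢 : Finset (Finset (V × Fin t)),
        (∀ F ∈ 𝒢, F.card = r) ∧
        (∀ E ∈ ℋ, ∀ U : V → Finset (V × Fin t),
          (∀ a ∈ E, ∀ x ∈ U a, x.1 = a) →
          (∀ a ∈ E, γ * t ≤ ((U a).card : ℝ)) →
          ∃ F ∈ 𝒢, ∀ a ∈ E, ∃ x ∈ U a, x ∈ F) ∧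
        (∀ S : Finset (Finset (V × Fin t)), S ⊆ 𝒢 → S.Nonempty →
          (S.biUnion id).card ≤ k →
          (r : ℝ) ≤ ((S.biUnion id).card : ℝ) + (1 + γ - r) * ((S.card : ℝ) - 1)) := by
  classical
  rcases ℋ.eq_empty_or_nonempty with rfl | ⟨E₀, hE₀⟩
  · refine ⟨1, one_pos, ∅, by simp, by simp, ?_⟩
    intro S hS hne
    rw [Finset.subset_empty] at hS
    simp [hS] at hne
  have hn : 0 < Fintype.card V := by
    have h1 := hunif E₀ hE₀
    have h2 := Finset.card_le_univ E₀
    omega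
  set n := Fintype.card V with hndef
  have hn' : (0 : ℝ) < n := by exact_mod_cast hn
  set q : ℝ := (γ / n) ^ r with hq
  have hq0 : 0 < q := by positivity
  let P : Finset (ℕ × ℕ) := (Finset.range (2 ^ k + 1) ×ˢ Finset.range (k + 1)).filter
    (fun p => 1 ≤ p.1 ∧ (p.2 : ℝ) + (1 + γ - r) * ((p.1 : ℝ) - 1) < r)
  have hP : ∀ p ∈ P, 1 ≤ p.1 ∧ (p.2 : ℝ) + (1 + γ - r) * ((p.1 : ℝ) - 1) < r :=
    fun p hp => (Finset.mem_filter.1 hp).2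
  set ε : ℝ := q / 8 / (P.card + 1) with hε
  have hε0 : 0 < ε := by positivity
  have hPε : (P.card : ℝ) * ε ≤ q / 8 := by
    rw [hε, mul_div_assoc', div_le_iff₀ (by positivity)]
    nlinarith
  obtain ⟨t, N, ht, hN1, hN2⟩ := rb_asym n r hr hn γ q ε hγ0 hq0 hε0 P hP
  have hcard : Fintype.card (V × Fin t) = n * t := by simp [hndef]
  have ht0 : (0 : ℝ) < t := by exact_mod_cast ht
  obtain ⟨f, hf1, hf2⟩ := rb_good (W := V × Fin t) r N q ε hq0 P
    (by rw [hcard]; positivity) hPε (by rw [hcard]; exact hN1) (by rw [hcard]; exact hN2)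
  have hpick : ∀ x : Finset (Fin N) × Finset (V × Fin t), x ∈ rbBad P f → ∃ i, i ∈ x.1 := by
    intro x hx
    have h1 := hP _ (Finset.mem_filter.1 hx).2.1
    exact Finset.card_pos.1 h1.1
  choose pick hpick using hpick
  let D : Finset (Fin N) := (rbBad P f).attach.image (fun x => pick x.1 x.2)
  have hD : D.card ≤ (rbBad P f).card := by
    refine Finset.card_image_le.trans ?_
    simp
  let e : Fin N → Finset (V × Fin t) := fun i => Finset.univ.image (f i)
  refine ⟨t, ht, ((Finset.univ \ D).image e).filter (fun F => F.card = r), ?_, ?_, ?_⟩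
  · intro F hF
    exact (Finset.mem_filter.1 hF).2
  · intro E hE U hU1 hU2
    have hEr := hunif E hE
    let g : Fin r ≃ E := (Finset.equivFinOfCardEq hEr).symm
    let A : Fin r → Finset (V × Fin t) := fun j => U (g j)
    have hA : q * (Fintype.card (V × Fin t) : ℝ) ^ r ≤ (Fintype.piFinset A).card := by
      rw [hcard, Fintype.card_piFinset, hq, ← mul_pow]
      push_cast
      rw [show γ / n * ((n : ℝ) * t) = γ * t by field_simp]
      calc (γ * t) ^ r = ∏ j : Fin r, (γ * t : ℝ) := by simp
        _ ≤ _ := Finset.prod_le_prod (fun _ _ => by positivity)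
            (fun j _ => hU2 _ (g j).2)
    have h1 := hf2 A hA
    have h2 : D.card < (Finset.univ.filter (fun i => f i ∈ Fintype.piFinset A)).card := by
      have h3 : (D.card : ℝ) ≤ (rbBad P f).card := by exact_mod_cast hD
      exact_mod_cast (h3.trans_lt hf1).trans h1
    obtain ⟨i, hi1, hi2⟩ := Finset.exists_mem_notMem_of_card_lt_card h2
    have hi := Fintype.mem_piFinset.1 (Finset.mem_filter.1 hi1).2
    have hfst : ∀ j, (f i j).1 = g j := fun j => hU1 _ (g j).2 _ (hi j)
    have hinj : Function.Injective (f i) := by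
      intro j j' hjj
      apply g.injective
      apply Subtype.ext
      rw [← hfst, ← hfst, hjj]
    refine ⟨e i, ?_, ?_⟩
    · refine Finset.mem_filter.2 ⟨Finset.mem_image_of_mem _ (by simp [hi2]), ?_⟩
      simp [e, Finset.card_image_of_injective _ hinj]
    · intro a ha
      refine ⟨f i (g.symm ⟨a, ha⟩), ?_, by simp [e]⟩
      have := hi (g.symm ⟨a, ha⟩)
      simpa [A] using this
  · intro S hS hne hv
    by_contra hlt
    push Not at hlt
    set T := S.biUnion id with hT
    have hm : S.card ≤ 2 ^ k := by
      have h1 : S ⊆ T.powerset := by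
        intro F hF
        rw [Finset.mem_powerset]
        exact Finset.subset_biUnion_of_mem id hF
      calc S.card ≤ 2 ^ T.card := by
            rw [← Finset.card_powerset]; exact Finset.card_le_card h1
        _ ≤ 2 ^ k := Nat.pow_le_pow_right (by norm_num) hv
    have hsurj : Set.SurjOn e ((Finset.univ \ D : Finset (Fin N)) : Set (Fin N)) S := by
      intro F hF
      have := Finset.mem_image.1 (Finset.mem_filter.1 (hS hF)).1
      obtain ⟨i, hi, hiF⟩ := this
      exact ⟨i, hi, hiF⟩
    obtain ⟨I, hI1, hI2, hI3⟩ := Finset.exists_subset_injOn_image_eq_of_surjOn _ S hsurj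
    have hIc : I.card = S.card := by rw [← hI3, Finset.card_image_of_injOn hI2]
    have hbad : (I, T) ∈ rbBad P f := by
      refine Finset.mem_filter.2 ⟨Finset.mem_univ _, ?_, ?_⟩
      · refine Finset.mem_filter.2 ⟨?_, ?_, ?_⟩
        · simp only [Finset.mem_product, Finset.mem_range, hIc]
          omega
        · simp only [hIc]; exact Finset.card_pos.2 hne
        · simp only [hIc]; exact hlt
      · intro i hi
        rw [Fintype.mem_piFinset]
        intro j
        have h1 : e i ∈ S := by rw [← hI3]; exact Finset.mem_image_of_mem _ hi
        exact Finset.subset_biUnion_of_mem id h1 (by simp [e])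
    have h1 := hpick _ hbad
    have h2 : pick _ hbad ∈ D :=
      Finset.mem_image.2 ⟨⟨_, hbad⟩, Finset.mem_attach _ _, rfl⟩
    have h3 := hI1 h1
    simp [h2] at h3
end
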